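/- The perfectly correlated distribution on three binary variables, defined by P(a,b,c) = 1/2 if a = b = c and P(a,b,c) = 0 otherwise, is not compatible with the Triangle scenario. -/

import Mathlib

open scoped BigOperators NNReal

/-- Compatibility of a distribution on `{0,1}³` with the Triangle causal scenario:
there are latent variables `X`, `Y`, `Z` with probability mass functions, and conditional
distributions for each observed node given its two latent parents, reproducing `P`. -/
def TriangleCompatible (P : Fin 2 → Fin 2 → Fin 2 → ℝ) : Prop :=
  ∃ (X Y Z : Type) (μX : X → ℝ≥0) (μY : Y → ℝ≥0) (μZ : Z → ℝ≥0)
    (qA : Y × Z → Fin 2 → ℝ≥0) (qB : X × Z → Fin 2 → ℝ≥0) (qC : X × Y → Fin 2 → ℝ≥0),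
    (∑' x, μX x) = 1 ∧ (∑' y, μY y) = 1 ∧ (∑' z, μZ z) = 1 ∧
    (∀ yz, ∑ a, qA yz a = 1) ∧
    (∀ xz, ∑ b, qB xz b = 1) ∧
    (∀ xy, ∑ c, qC xy c = 1) ∧
    ∀ a b c, P a b c =
      ((∑' (x : X) (y : Y) (z : Z),
        μX x * μY y * μZ z * qA (y, z) a * qB (x, z) b * qC (x, y) c : ℝ≥0) : ℝ)

theorem summable_of_tsum_eq_one {ι : Type*} {f : ι → ℝ≥0} (h : ∑' i, f i = 1) : Summable f := by
  by_contra hf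
  simp [tsum_eq_zero_of_not_summable hf] at h

theorem eq_zero_of_tsum_tsum_tsum_eq_zero {X Y Z : Type*} {μX : X → ℝ≥0} {μY : Y → ℝ≥0}
    {μZ : Z → ℝ≥0} (hX : ∑' x, μX x = 1) (hY : ∑' y, μY y = 1) (hZ : ∑' z, μZ z = 1)
    {f : X → Y → Z → ℝ≥0} (hf : ∀ x y z, f x y z ≤ μX x * μY y * μZ z)
    (h : ∑' (x) (y) (z), f x y z = 0) (x : X) (y : Y) (z : Z) : f x y z = 0 := by
  have sX := summable_of_tsum_eq_one hX
  have sY := summable_of_tsum_eq_one hY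
  have sZ := summable_of_tsum_eq_one hZ
  have s₁ (x y) : Summable (f x y) := NNReal.summable_of_le (hf x y) (sZ.mul_left _)
  have b₁ (x y) : ∑' z, f x y z ≤ μX x * μY y :=
    ((s₁ x y).tsum_le_tsum (hf x y) (sZ.mul_left _)).trans_eq
      (by rw [NNReal.tsum_mul_left, hZ, mul_one])
  have s₂ (x) : Summable fun y => ∑' z, f x y z := NNReal.summable_of_le (b₁ x) (sY.mul_left _)
  have b₂ (x) : ∑' y, ∑' z, f x y z ≤ μX x :=
    ((s₂ x).tsum_le_tsum (b₁ x) (sY.mul_left _)).trans_eq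
      (by rw [NNReal.tsum_mul_left, hY, mul_one])
  have s₃ : Summable fun x => ∑' y, ∑' z, f x y z := NNReal.summable_of_le b₂ sX
  have h₂ := hasSum_zero_iff.mp (h ▸ s₃.hasSum) x
  have h₁ := hasSum_zero_iff.mp (h₂ ▸ (s₂ x).hasSum) y
  exact hasSum_zero_iff.mp (h₁ ▸ (s₁ x y).hasSum) z

theorem exists_ne_zero_of_tsum_tsum_tsum_ne_zero {X Y Z : Type*} {f : X → Y → Z → ℝ≥0}
    (h : ∑' (x) (y) (z), f x y z ≠ 0) : ∃ x y z, f x y z ≠ 0 := by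
  contrapose! h
  simp [h]

theorem le_one_of_sum_eq_one {ι : Type*} [Fintype ι] {q : ι → ℝ≥0} (h : ∑ i, q i = 1) (i : ι) :
    q i ≤ 1 :=
  h ▸ Finset.single_le_sum (fun _ _ => zero_le) (Finset.mem_univ i)

theorem exists_ne_zero_of_sum_eq_one {ι : Type*} [Fintype ι] {q : ι → ℝ≥0} (h : ∑ i, q i = 1) :
    ∃ i, q i ≠ 0 := by
  contrapose! h
  simp [h]

/-- The perfectly correlated distribution on three binary variables
(`P(a,b,c) = 1/2` if `a = b = c`, else `0`) is not compatible with the Triangle scenario. -/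
theorem ghz_not_triangle_compatible :
    ¬ TriangleCompatible (fun a b c => if a = b ∧ b = c then (1 : ℝ) / 2 else 0) := by
  rintro ⟨X, Y, Z, μX, μY, μZ, qA, qB, qC, hX, hY, hZ, hA, hB, hC, hP⟩
  have outcomes_eq {x y z a b c} (hx : μX x ≠ 0) (hy : μY y ≠ 0) (hz : μZ z ≠ 0)
      (ha : qA (y, z) a ≠ 0) (hb : qB (x, z) b ≠ 0) (hc : qC (x, y) c ≠ 0) :
      a = b ∧ b = c := by
    by_contra hne
    have h := hP a b c
    beta_reduce at h
    rw [if_neg hne, eq_comm, NNReal.coe_eq_zero] at h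
    have h₀ := eq_zero_of_tsum_tsum_tsum_eq_zero hX hY hZ (fun x y z =>
      mul_le_of_le_of_le_one (mul_le_of_le_of_le_one (mul_le_of_le_of_le_one le_rfl
        (le_one_of_sum_eq_one (hA _) _)) (le_one_of_sum_eq_one (hB _) _))
        (le_one_of_sum_eq_one (hC _) _)) h x y z
    simp_all
  have exists_support (a : Fin 2) : ∃ x y z,
      μX x * μY y * μZ z * qA (y, z) a * qB (x, z) a * qC (x, y) a ≠ 0 := by
    apply exists_ne_zero_of_tsum_tsum_tsum_ne_zero
    intro h
    have := hP a a a
    rw [h] at this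
    norm_num at this
  obtain ⟨x, y, z, h⟩ := exists_support 0
  obtain ⟨x', y', z', h'⟩ := exists_support 1
  simp only [mul_ne_zero_iff] at h h'
  obtain ⟨⟨⟨⟨⟨hx, -⟩, hz⟩, -⟩, hb⟩, -⟩ := h
  obtain ⟨⟨⟨⟨⟨-, hy'⟩, hz'⟩, ha'⟩, -⟩, -⟩ := h'
  obtain ⟨c, hc⟩ := exists_ne_zero_of_sum_eq_one (hC (x, y'))
  obtain ⟨a, ha⟩ := exists_ne_zero_of_sum_eq_one (hA (y', z))
  obtain ⟨b, hb'⟩ := exists_ne_zero_of_sum_eq_one (hB (x, z'))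
  have h₀ := (outcomes_eq hx hy' hz ha hb hc).2
  have h₁ := outcomes_eq hx hy' hz' ha' hb' hc
  exact zero_ne_one (h₀.trans (h₁.1.trans h₁.2).symm)
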